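/- Let π = ∏_{j=1}^{m} t_{k_j}^{i_{k_j}} be a standard OGS elementary element of S_n, i.e. 2 ≤ k_1 < k_2 < ⋯ < k_m ≤ n, 0 < i_{k_j} < k_j for each j, and Σ_{j=1}^{m} i_{k_j} ≤ k_1. Then the Coxeter length of π satisfies ℓ(π) = Σ_{j=1}^{m} k_j·i_{k_j} − (Σ_{j=1}^{m} i_{k_j})². -/

import Mathlib

/-!
Setup for the symmetric group `Sₙ`, realized as `Equiv.Perm (Fin n)` with `Fin n`
encoding `{1, …, n}` (0-indexed positions).  The paper multiplies permutations
left-to-right: `(π·σ)(i) = σ(π(i))`, while Mathlib composes right-to-left: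
`(π * σ) i = π (σ i)`.  Hence a paper product `a₁ · a₂ ⋯ a_k` is encoded as the
Mathlib product `a_k * ⋯ * a₂ * a₁` (the leftmost paper factor acts first).
-/

open Equiv Finset

/-- The adjacent transposition `sᵢ` (1-indexed values): the transposition `(i, i+1)`,
as a permutation of `Fin n`; junk value `1` outside the range `1 ≤ i ≤ n-1`. -/
def sP (n : ℕ) (i : ℕ) : Equiv.Perm (Fin n) :=
  if h : i < n then Equiv.swap ⟨i - 1, by omega⟩ ⟨i, h⟩ else 1

/-- `tₘ = s₁·s₂⋯s_{m−1}` (left-to-right), i.e. the `m`-cycle sending `1 ↦ m` and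
`j ↦ j−1` for `2 ≤ j ≤ m` (1-indexed), fixing every `j > m`; `t₁ = 1`. -/
def tP (n : ℕ) (m : ℕ) : Equiv.Perm (Fin n) :=
  if h : m - 1 < n then ((⟨m - 1, h⟩ : Fin n).cycleRange)⁻¹ else 1

/-- The paper's left-to-right product `f a · f (a+1) ⋯ f b` (increasing indices,
so `f a` acts first), encoded in Mathlib's composition order. -/
def ogsProd {n : ℕ} (a b : ℕ) (f : ℕ → Equiv.Perm (Fin n)) : Equiv.Perm (Fin n) :=
  ((List.range' a (b + 1 - a)).map f).reverse.prod

/-- The paper's left-to-right product `f b · f (b−1) ⋯ f a` (decreasing indices,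
so `f b` acts first), encoded in Mathlib's composition order. -/
def ogsProdDesc {n : ℕ} (a b : ℕ) (f : ℕ → Equiv.Perm (Fin n)) : Equiv.Perm (Fin n) :=
  ((List.range' a (b + 1 - a)).map f).prod

/-- The Coxeter length of `π`: the number of inversions, i.e. of pairs `i < j`
with `π(i) > π(j)`. -/
def len {n : ℕ} (π : Equiv.Perm (Fin n)) : ℕ :=
  (Finset.univ.filter fun p : Fin n × Fin n => p.1 < p.2 ∧ π p.2 < π p.1).card

/-- The descent set of `π`: the set of 1-indexed positions `i ∈ {1, …, n−1}`
with `π(i) > π(i+1)`. -/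
def descents {n : ℕ} (π : Equiv.Perm (Fin n)) : Finset ℕ :=
  (Finset.Ico 1 n).filter fun i => ∃ h : i < n, π ⟨i, h⟩ < π ⟨i - 1, by omega⟩

/-- The cycle `tP n k` sends `0` to `k - 1`, shifts `1, …, k - 1` down by one, and fixes the rest
(0-indexed). -/
theorem tP_apply_val {n k : ℕ} (hk : 1 ≤ k) (hkn : k ≤ n) (x : Fin n) :
    (tP n k x : ℕ) = if (x : ℕ) = 0 then k - 1 else if (x : ℕ) < k then x - 1 else x := by
  have hlt : k - 1 < n := by omega
  have hy : (if (x : ℕ) = 0 then k - 1 else if (x : ℕ) < k then x - 1 else (x : ℕ)) < n := by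
    split_ifs <;> omega
  have key : tP n k x = ⟨_, hy⟩ := by
    rw [tP, dif_pos hlt, Equiv.Perm.inv_eq_iff_eq]
    have : NeZero n := ⟨by omega⟩
    rcases Nat.lt_or_ge x k with hx | hx
    · by_cases h0 : (x : ℕ) = 0
      · rw [Fin.cycleRange_of_eq (by ext; simp [h0])]
        ext; simp [h0]
      · ext
        rw [Fin.coe_cycleRange_of_lt (by rw [Fin.lt_def]; simp [h0, hx]; omega)]
        simp [h0, hx]; omega
    · rw [Fin.cycleRange_of_gt (by simp only [Fin.lt_def]; split_ifs <;> omega)]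
      ext
      simp only
      split_ifs <;> omega
  rw [key]

/-- For `i ≤ k`, the power `tP n k ^ i` exchanges the blocks `[0, i)` and `[i, k)` of values. -/
theorem tP_pow_apply_val {n k : ℕ} (hk : 1 ≤ k) (hkn : k ≤ n) {i : ℕ} (hi : i ≤ k) (x : Fin n) :
    ((tP n k ^ i) x : ℕ) =
      if (x : ℕ) < i then x + k - i else if (x : ℕ) < k then x - i else x := by
  induction i with
  | zero => simp
  | succ i ih =>
    rw [pow_succ', Equiv.Perm.mul_apply, tP_apply_val hk hkn, ih (by omega)]
    split_ifs <;> omega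

theorem ogsProd_one_succ {n : ℕ} (j : ℕ) (f : ℕ → Equiv.Perm (Fin n)) :
    ogsProd 1 (j + 1) f = f (j + 1) * ogsProd 1 j f := by
  simp [ogsProd, List.range'_concat, add_comm]

theorem card_filter_val_Ico {n a b : ℕ} (hb : b ≤ n) :
    (Finset.univ.filter fun x : Fin n => a ≤ (x : ℕ) ∧ (x : ℕ) < b).card = b - a := by
  rw [← Nat.card_Ico, ← Finset.card_map Fin.valEmbedding]
  congr 1
  ext y
  simp only [Finset.mem_map, Finset.mem_filter, Finset.mem_univ, true_and, Fin.valEmbedding_apply,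
    Finset.mem_Ico]
  constructor
  · rintro ⟨x, hx, rfl⟩
    exact hx
  · intro hy
    exact ⟨⟨y, by omega⟩, hy, rfl⟩

/-- If `σ` shifts the positions `[a, a + i)` onto the values `[0, i)` and fixes everything from `k`
on, then composing with `tP n k ^ i` destroys the inversions `[0, a) × [a, a + i)` and creates the
inversions `[a, a + i) × [a + i, k)`. -/
theorem len_tP_pow_mul {n k a i : ℕ} (hk : 1 ≤ k) (hkn : k ≤ n) (hai : a + i ≤ k)
    (σ : Equiv.Perm (Fin n))
    (hshift : ∀ x : Fin n, a ≤ (x : ℕ) → (x : ℕ) < a + i → (σ x : ℕ) = x - a)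
    (hfix : ∀ x : Fin n, k ≤ (x : ℕ) → σ x = x) :
    len (tP n k ^ i * σ) + a * i = len σ + i * (k - (a + i)) := by
  have hlt (x : Fin n) (hx : (x : ℕ) < k) : (σ x : ℕ) < k := by
    by_contra! h
    have := σ.injective (hfix _ h)
    rw [this] at h
    omega
  have hge (x : Fin n) (hx : (σ x : ℕ) < i) : a ≤ (x : ℕ) ∧ (x : ℕ) < a + i := by
    have hy := hshift ⟨σ x + a, by omega⟩ (by simp) (by simp; omega)
    have hxy : (⟨σ x + a, by omega⟩ : Fin n) = x := σ.injective (Fin.ext (by simpa using hy))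
    have := congrArg Fin.val hxy
    simp only at this
    omega
  let lost : Finset (Fin n × Fin n) :=
    (univ.filter fun x : Fin n => 0 ≤ (x : ℕ) ∧ (x : ℕ) < a) ×ˢ
      (univ.filter fun x : Fin n => a ≤ (x : ℕ) ∧ (x : ℕ) < a + i)
  let gained : Finset (Fin n × Fin n) :=
    (univ.filter fun x : Fin n => a ≤ (x : ℕ) ∧ (x : ℕ) < a + i) ×ˢ
      (univ.filter fun x : Fin n => a + i ≤ (x : ℕ) ∧ (x : ℕ) < k)
  have hlost : lost.card = a * i := by
    rw [Finset.card_product, card_filter_val_Ico (by omega), card_filter_val_Ico (by omega)]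
    simp
  have hgained : gained.card = i * (k - (a + i)) := by
    rw [Finset.card_product, card_filter_val_Ico (by omega), card_filter_val_Ico (by omega)]
    simp
  have hcases (x : Fin n) :
      (a ≤ (x : ℕ) ∧ (x : ℕ) < a + i ∧ (σ x : ℕ) = x - a ∧
        ((tP n k ^ i) (σ x) : ℕ) = x - a + k - i) ∨
      (((x : ℕ) < a ∨ a + i ≤ (x : ℕ)) ∧ (x : ℕ) < k ∧ i ≤ (σ x : ℕ) ∧ (σ x : ℕ) < k ∧
        ((tP n k ^ i) (σ x) : ℕ) = σ x - i) ∨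
      (k ≤ (x : ℕ) ∧ (σ x : ℕ) = x ∧ ((tP n k ^ i) (σ x) : ℕ) = x) := by
    have h1 := hshift x
    have h2 := hlt x
    have h3 := hge x
    have h4 : k ≤ (x : ℕ) → (σ x : ℕ) = x := fun h => congrArg Fin.val (hfix x h)
    rw [tP_pow_apply_val hk hkn (by omega)]
    split_ifs <;> omega
  rw [← hlost, ← hgained, len, len, ← Finset.card_union_of_disjoint,
    ← Finset.card_union_of_disjoint]
  · congr 1
    ext ⟨x, y⟩
    simp only [lost, gained, Finset.mem_union, Finset.mem_filter, Finset.mem_product,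
      Finset.mem_univ, true_and, Equiv.Perm.mul_apply, Fin.lt_def]
    have hx := hcases x
    have hy := hcases y
    omega
  · rw [Finset.disjoint_left]
    rintro ⟨x, y⟩
    simp only [gained, Finset.mem_filter, Finset.mem_product, Finset.mem_univ, true_and,
      Fin.lt_def]
    have hx := hcases x
    have hy := hcases y
    omega
  · rw [Finset.disjoint_left]
    rintro ⟨x, y⟩
    simp only [lost, Finset.mem_filter, Finset.mem_product, Finset.mem_univ, true_and,
      Equiv.Perm.mul_apply, Fin.lt_def]
    have hx := hcases x
    have hy := hcases y
    omega

/-- If `π = ∏_{j=1}^{m} t_{k_j}^{i_j}` is a standard OGS elementary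
element of `Sₙ` (`2 ≤ k₁ < ⋯ < k_m ≤ n`, `0 < i_j < k_j`, `Σ i_j ≤ k₁`), then
`ℓ(π) = Σ_{j=1}^{m} k_j·i_j − (Σ_{j=1}^{m} i_j)²`. -/
theorem elementary_length (n m : ℕ) (k i : ℕ → ℕ) (hm : 1 ≤ m)
    (hk : ∀ j, 1 ≤ j → j ≤ m → 2 ≤ k j ∧ k j ≤ n)
    (hmono : ∀ j, 1 ≤ j → j < m → k j < k (j + 1))
    (hi : ∀ j, 1 ≤ j → j ≤ m → 0 < i j ∧ i j < k j)
    (hsum : ∑ j ∈ Finset.Icc 1 m, i j ≤ k 1)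
    (π : Equiv.Perm (Fin n)) (hπ : π = ogsProd 1 m fun j => tP n (k j) ^ i j) :
    len π = (∑ j ∈ Finset.Icc 1 m, k j * i j) - (∑ j ∈ Finset.Icc 1 m, i j) ^ 2 := by
  have invariant (j : ℕ) (hj : j ≤ m) :
      (1 ≤ j → k 1 ≤ k j) ∧
      (∀ x : Fin n, ∑ l ∈ Finset.Icc 1 j, i l ≤ (x : ℕ) → (x : ℕ) < k 1 →
        (ogsProd 1 j (fun l => tP n (k l) ^ i l) x : ℕ) = x - ∑ l ∈ Finset.Icc 1 j, i l) ∧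
      (∀ x : Fin n, (1 ≤ j → k j ≤ (x : ℕ)) → ogsProd 1 j (fun l => tP n (k l) ^ i l) x = x) ∧
      len (ogsProd 1 j fun l => tP n (k l) ^ i l) + (∑ l ∈ Finset.Icc 1 j, i l) ^ 2 =
        ∑ l ∈ Finset.Icc 1 j, k l * i l := by
    induction j with
    | zero =>
      refine ⟨by simp, by simp [ogsProd], by simp [ogsProd], ?_⟩
      simp only [len, ogsProd]
      simpa [Finset.filter_eq_empty_iff] using fun a b h => le_of_lt h
    | succ j ih =>
      obtain ⟨hle, hshift, hfix, hlen⟩ := ih (by omega)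
      have hpartial : ∑ l ∈ Finset.Icc 1 (j + 1), i l ≤ k 1 :=
        (Finset.sum_le_sum_of_subset (Finset.Icc_subset_Icc_right hj)).trans hsum
      rw [ogsProd_one_succ, Finset.sum_Icc_succ_top (by omega), Finset.sum_Icc_succ_top (by omega)]
      rw [Finset.sum_Icc_succ_top (by omega)] at hpartial
      set a := ∑ l ∈ Finset.Icc 1 j, i l
      set σ := ogsProd 1 j fun l => tP n (k l) ^ i l
      obtain ⟨hk2, hkn⟩ := hk (j + 1) (by omega) hj
      have hik := (hi (j + 1) (by omega) hj).2
      have hstep : 1 ≤ j → k j < k (j + 1) := fun h => hmono j h (by omega)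
      have hk1 : k 1 ≤ k (j + 1) := by
        rcases Nat.eq_zero_or_pos j with rfl | h
        · simp
        · exact (hle h).trans (hstep h).le
      have hfix' (x : Fin n) (hx : k (j + 1) ≤ (x : ℕ)) : σ x = x :=
        hfix x fun h => (hstep h).le.trans hx
      refine ⟨fun _ => hk1, fun x hx hxk => ?_, fun x hx => ?_, ?_⟩
      · have hσ := hshift x (by omega) hxk
        rw [Equiv.Perm.mul_apply, tP_pow_apply_val (by omega) hkn hik.le, hσ]
        split_ifs <;> omega
      · have hx' := hx (by omega)
        ext
        rw [Equiv.Perm.mul_apply, hfix' x hx', tP_pow_apply_val (by omega) hkn hik.le]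
        split_ifs <;> omega
      · have h := len_tP_pow_mul (by omega) hkn (hpartial.trans hk1) σ
          (fun x h1 h2 => hshift x h1 (by omega)) hfix'
        obtain ⟨d, hd⟩ := Nat.exists_eq_add_of_le (hpartial.trans hk1)
        rw [hd, Nat.add_sub_cancel_left] at h
        rw [hd]
        nlinarith
  rw [hπ, ← (invariant m le_rfl).2.2.2, Nat.add_sub_cancel]
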